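/- (Intermediate step in the proof of Theorem 3.2(b).) If ∫₀^∞ g(s) ds = 1, then 0 < ∫₀^∞ s·g(s) ds < ∞ and y(t) → (∫₀^∞ f(s) ds) / (∫₀^∞ s·g(s) ds) as t → ∞. -/

import Mathlib

open MeasureTheory Filter Set

/-- Integration of `u ↦ ψ (t + u)` over `[-α, 0]` against a finite signed Borel
measure `ν`, realised via its Jordan decomposition:
`Gν α ν ψ t = ∫_{[-α,0]} ψ(t+u) ν(du)`. -/
noncomputable def Gν (α : ℝ) (ν : MeasureTheory.SignedMeasure ℝ) (ψ : ℝ → ℝ) (t : ℝ) : ℝ :=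
  (∫ u in Set.Icc (-α) 0, ψ (t + u) ∂ν.toJordanDecomposition.posPart) -
  (∫ u in Set.Icc (-α) 0, ψ (t + u) ∂ν.toJordanDecomposition.negPart)

/-- Nonnegative, measurable, causal and locally bounded. -/
structure LB (V : ℝ → ℝ) : Prop where
  meas : Measurable V
  nn : ∀ t, 0 ≤ V t
  neg : ∀ t < 0, V t = 0
  bd : ∀ T : ℝ, ∃ K : ℝ, ∀ t ≤ T, V t ≤ K

/-- A causal probability density. -/
structure PD (g : ℝ → ℝ) : Prop where
  meas : Measurable g
  nn : ∀ t, 0 ≤ g t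
  neg : ∀ t < 0, g t = 0
  int : Integrable g
  one : ∫ u, g u = 1

theorem LB.intOn {V : ℝ → ℝ} (h : LB V) (T : ℝ) : IntegrableOn V (Iic T) := by
  obtain ⟨K, hK⟩ := h.bd T
  have h1 : Integrable ((Icc 0 T).indicator (fun _ : ℝ => K)) :=
    (integrable_indicator_iff measurableSet_Icc).2 (by simp)
  refine Integrable.mono' h1.integrableOn h.meas.aestronglyMeasurable ?_
  filter_upwards [ae_restrict_mem measurableSet_Iic] with t ht
  rw [Real.norm_of_nonneg (h.nn t)]
  by_cases h0 : t < 0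
  · rw [h.neg t h0]
    rw [indicator_of_notMem (by simp [h0])]
  · rw [indicator_of_mem (by exact ⟨not_lt.1 h0, ht⟩)]
    exact hK t ht

theorem PD.cint {g : ℝ → ℝ} (hg : PD g) {V : ℝ → ℝ} (hV : Measurable V) {K t : ℝ}
    (hK : ∀ s ≤ t, |V s| ≤ K) : Integrable (fun u => g u * V (t - u)) := by
  refine Integrable.mono' (hg.int.mul_const K) ?_ ?_
  · exact (hg.meas.mul (hV.comp (measurable_const.sub measurable_id))).aestronglyMeasurable
  · refine Eventually.of_forall fun u => ?_
    rw [norm_mul, Real.norm_of_nonneg (hg.nn u)]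
    by_cases h0 : u < 0
    · simp [hg.neg u h0]
    · exact mul_le_mul_of_nonneg_left (hK _ (by linarith)) (hg.nn u)

theorem LB.cint {g V : ℝ → ℝ} (hg : PD g) (hV : LB V) (t : ℝ) :
    Integrable (fun u => g u * V (t - u)) := by
  obtain ⟨K, hK⟩ := hV.bd t
  exact hg.cint hV.meas (K := K) fun s hs => by rw [abs_of_nonneg (hV.nn s)]; exact hK s hs

theorem LB.pint {g V : ℝ → ℝ} (hg : PD g) (hV : LB V) (T : ℝ) :
    Integrable (Function.uncurry fun t u => g u * V (t - u))
      ((volume.restrict (Iic T)).prod volume) := by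
  obtain ⟨K, hK⟩ := hV.bd T
  have h1 : Integrable ((Icc 0 T).indicator (fun _ : ℝ => K)) :=
    (integrable_indicator_iff measurableSet_Icc).2 (by simp)
  have h2 := (h1.restrict (s := Iic T)).mul_prod hg.int
  refine Integrable.mono' h2 ?_ ?_
  · apply Measurable.aestronglyMeasurable
    exact (hg.meas.comp measurable_snd).mul (hV.meas.comp (measurable_fst.sub measurable_snd))
  · have h3 := (Measure.quasiMeasurePreserving_fst (μ := volume.restrict (Iic T))
      (ν := (volume : Measure ℝ))).ae (ae_restrict_mem measurableSet_Iic)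
    filter_upwards [h3] with p hp
    obtain ⟨t, u⟩ := p
    simp only [mem_Iic] at hp
    simp only [Function.uncurry]
    rw [norm_mul, Real.norm_of_nonneg (hg.nn u), Real.norm_of_nonneg (hV.nn _)]
    by_cases h0 : u < 0
    · simp [hg.neg u h0]
    push Not at h0
    by_cases h1 : t < 0
    · rw [hV.neg (t - u) (by linarith), indicator_of_notMem (by simp [h1])]; simp
    · rw [indicator_of_mem (by exact ⟨not_lt.1 h1, hp⟩), mul_comm]
      exact mul_le_mul_of_nonneg_right (hK _ (by linarith)) (hg.nn u)

theorem setInt_shift (V : ℝ → ℝ) (T u : ℝ) :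
    ∫ t in Iic T, V (t - u) = ∫ t in Iic (T - u), V t := by
  rw [← integral_indicator measurableSet_Iic, ← integral_indicator measurableSet_Iic,
    ← integral_sub_right_eq_self ((Iic (T - u)).indicator V) u]
  congr 1
  ext t
  simp [indicator]

theorem LB.fub {g V : ℝ → ℝ} (hg : PD g) (hV : LB V) (T : ℝ) :
    ∫ t in Iic T, ∫ u, g u * V (t - u) = ∫ u, g u * ∫ t in Iic (T - u), V t := by
  rw [integral_integral_swap (hV.pint hg T)]
  congr 1
  ext u
  rw [integral_const_mul, setInt_shift]

theorem LB.fubint {g V : ℝ → ℝ} (hg : PD g) (hV : LB V) (T : ℝ) :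
    Integrable (fun u => g u * ∫ t in Iic (T - u), V t) := by
  refine (hV.pint hg T).integral_prod_right.congr (Eventually.of_forall fun u => ?_)
  simp only [Function.uncurry]
  rw [integral_const_mul, setInt_shift]

theorem LB.mono {V : ℝ → ℝ} (hV : LB V) {a b : ℝ} (h : a ≤ b) :
    ∫ t in Iic a, V t ≤ ∫ t in Iic b, V t :=
  setIntegral_mono_set (hV.intOn b) (Eventually.of_forall hV.nn)
    (Iic_subset_Iic.2 h).eventuallyLE

/-- Variance identity. -/
theorem PD.var {g : ℝ → ℝ} (hg : PD g) {V : ℝ → ℝ} (hV : Measurable V) {K t : ℝ}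
    (hK : ∀ s ≤ t, |V s| ≤ K) :
    Integrable (fun u => g u * (V (t - u) - ∫ u, g u * V (t - u)) ^ 2) ∧
    ∫ u, g u * (V (t - u) - ∫ u, g u * V (t - u)) ^ 2 =
      (∫ u, g u * V (t - u) ^ 2) - (∫ u, g u * V (t - u)) ^ 2 := by
  set m := ∫ u, g u * V (t - u) with hm
  have h1 := hg.cint hV hK
  have h2 : Integrable (fun u => g u * V (t - u) ^ 2) :=
    hg.cint (V := fun s => V s ^ 2) (hV.pow_const 2) (K := K ^ 2) fun s hs => by
      rw [abs_pow]; exact pow_le_pow_left₀ (abs_nonneg _) (hK s hs) 2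
  have e : (fun u => g u * (V (t - u) - m) ^ 2) =
      fun u => (g u * V (t - u) ^ 2 - 2 * m * (g u * V (t - u))) + m ^ 2 * g u := by
    ext u; ring
  rw [e]
  refine ⟨(h2.sub (h1.const_mul _)).add (hg.int.const_mul _), ?_⟩
  rw [integral_add (f := fun u => g u * V (t - u) ^ 2 - 2 * m * (g u * V (t - u)))
    (h2.sub (h1.const_mul _)) (hg.int.const_mul _),
    integral_sub h2 (h1.const_mul _), integral_const_mul, integral_const_mul, hg.one, ← hm]
  ring

/-- Data of the renewal equation on the line. -/
structure RN (F g Y : ℝ → ℝ) : Prop where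
  hF : LB F
  hg : PD g
  hY : LB Y
  Fb : ∃ M, ∀ t, F t ≤ M
  gb : ∃ M, ∀ t, g t ≤ M
  Fi : Integrable F
  sgi : Integrable (fun u => u * g u)
  Flim : Tendsto F atTop (nhds 0)
  glim : Tendsto g atTop (nhds 0)
  eq : ∀ t, Y t = F t + ∫ u, g u * Y (t - u)

theorem RN.cons {F g Y : ℝ → ℝ} (h : RN F g Y) (T : ℝ) :
    Integrable (fun u => g u * ((∫ t in Iic T, Y t) - ∫ t in Iic (T - u), Y t)) ∧
    ∫ u, g u * ((∫ t in Iic T, Y t) - ∫ t in Iic (T - u), Y t) = ∫ t in Iic T, F t := by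
  have h1 := h.hY.fubint h.hg T
  have e : (fun u => g u * ((∫ t in Iic T, Y t) - ∫ t in Iic (T - u), Y t)) =
    fun u => g u * (∫ t in Iic T, Y t) - g u * ∫ t in Iic (T - u), Y t := by
    ext u; ring
  rw [e]
  refine ⟨(h.hg.int.mul_const _).sub h1, ?_⟩
  rw [integral_sub (h.hg.int.mul_const _) h1, integral_mul_const, h.hg.one, ← h.hY.fub h.hg]
  have h2 : ∫ t in Iic T, Y t = ∫ t in Iic T, (F t + ∫ u, g u * Y (t - u)) :=
    integral_congr_ae (Eventually.of_forall h.eq)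
  have h3 : Integrable (fun t => ∫ u, g u * Y (t - u)) (volume.restrict (Iic T)) :=
    (h.hY.pint h.hg T).integral_prod_left
  rw [integral_add (h.hF.intOn T) h3] at h2
  linarith

theorem RN.Fle {F g Y : ℝ → ℝ} (h : RN F g Y) (T : ℝ) : ∫ t in Iic T, F t ≤ ∫ t, F t :=
  setIntegral_le_integral h.Fi (Eventually.of_forall h.hF.nn)

theorem PD.split {g : ℝ → ℝ} (hg : PD g) : ∃ A : ℝ, 0 < A ∧ ∫ u in Ioi A, g u = 1 / 2 := by
  have hc : Continuous (fun A => ∫ u in (0:ℝ)..A, g u) :=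
    intervalIntegral.continuous_primitive (fun a b => hg.int.intervalIntegrable) 0
  have e : ∀ A, (∫ u in (0:ℝ)..A, g u) = 1 - ∫ u in Ioi A, g u := by
    intro A
    have h0 : ∫ u in Iic (0:ℝ), g u = 0 := by
      rw [integral_Iic_eq_integral_Iio]
      rw [setIntegral_congr_fun (g := fun _ => (0:ℝ)) measurableSet_Iio]
      · simp
      · intro u hu; exact hg.neg u hu
    have h1 := intervalIntegral.integral_Iic_sub_Iic (a := (0:ℝ)) (b := A)
      hg.int.integrableOn hg.int.integrableOn
    have h2 := intervalIntegral.integral_Iic_add_Ioi (b := A)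
      hg.int.integrableOn hg.int.integrableOn
    rw [hg.one] at h2
    linarith
  have ht : Tendsto (fun A => ∫ u in (0:ℝ)..A, g u) atTop (nhds 1) := by
    have := tendsto_integral_Ioi_zero (f := g) (μ := volume) (tendsto_id (α := ℝ) (x := atTop))
    have h2 := this.const_sub 1
    simp only [sub_zero] at h2
    refine h2.congr fun A => (e A).symm
  obtain ⟨B, hB⟩ := ((ht.eventually (lt_mem_nhds (show (1/2:ℝ) < 1 by norm_num))).and
    (eventually_ge_atTop 0)).exists
  obtain ⟨A, hA, hA2⟩ := intermediate_value_Icc hB.2 hc.continuousOn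
    (show (1/2:ℝ) ∈ Icc _ _ from ⟨by simp, hB.1.le⟩)
  refine ⟨A, lt_of_le_of_ne hA.1 ?_, ?_⟩
  · rintro rfl; simp at hA2
  · have := e A; simp only at hA2; linarith

theorem LB.kform {Y : ℝ → ℝ} (hY : LB Y) (t u : ℝ) :
    (∫ s in Iic t, Y s) - ∫ s in Iic (t - u), Y s = ∫ a in (0:ℝ)..u, Y (t - a) := by
  rw [intervalIntegral.integral_comp_sub_left, sub_zero,
    intervalIntegral.integral_Iic_sub_Iic (hY.intOn _) (hY.intOn _)]

theorem LB.ii {Y : ℝ → ℝ} (hY : LB Y) (t u : ℝ) :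
    IntervalIntegrable (fun a => Y (t - a)) volume 0 u := by
  have h1 : IntervalIntegrable Y volume (t - 0) (t - u) := by
    constructor
    · exact (hY.intOn (t - u)).mono_set Ioc_subset_Iic_self
    · exact (hY.intOn (t - 0)).mono_set Ioc_subset_Iic_self
  simpa using h1.comp_sub_left t

theorem RN.window {F g Y : ℝ → ℝ} (h : RN F g Y) {A : ℝ}
    (hA2 : ∫ u in Ioi A, g u = 1 / 2) (t : ℝ) :
    ∫ a in (0:ℝ)..A, Y (t - a) ≤ 2 * ∫ s, F s := by
  obtain ⟨h1, h2⟩ := h.cons t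
  have h3 := h.Fle t
  rw [← h2] at h3
  rw [← h.hY.kform]
  set k := (∫ s in Iic t, Y s) - ∫ s in Iic (t - A), Y s with hk
  have h4 : ∫ u, (Ioi A).indicator (fun u => g u * k) u ≤
      ∫ u, g u * ((∫ s in Iic t, Y s) - ∫ s in Iic (t - u), Y s) := by
    refine integral_mono ((h.hg.int.mul_const _).indicator measurableSet_Ioi) h1 fun u => ?_
    by_cases hu : u ∈ Ioi A
    · rw [indicator_of_mem hu]
      refine mul_le_mul_of_nonneg_left ?_ (h.hg.nn u)
      have := h.hY.mono (show t - u ≤ t - A by simp only [mem_Ioi] at hu; linarith)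
      rw [hk]; linarith
    · rw [indicator_of_notMem hu]
      by_cases h0 : u < 0
      · simp [h.hg.neg u h0]
      · have := h.hY.mono (show t - u ≤ t by linarith)
        exact mul_nonneg (h.hg.nn u) (by linarith)
  rw [integral_indicator measurableSet_Ioi, integral_mul_const, hA2] at h4
  linarith

theorem RN.step {F g Y : ℝ → ℝ} (h : RN F g Y) : ∃ B : ℝ, ∀ T K : ℝ, 0 ≤ K →
    (∀ t ≤ T, Y t ≤ K) → ∀ t ≤ T, Y t ≤ B + K / 2 := by
  obtain ⟨A, hA, hA2⟩ := h.hg.split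
  obtain ⟨M, hM⟩ := h.Fb
  obtain ⟨N, hN⟩ := h.gb
  refine ⟨M + N * (2 * ∫ s, F s), fun T K hK0 hK t ht => ?_⟩
  have hN0 : 0 ≤ N := (h.hg.nn 0).trans (hN 0)
  have i1 : Integrable ((Ioc 0 A).indicator (fun u => N * Y (t - u))) := by
    rw [integrable_indicator_iff measurableSet_Ioc]
    exact (h.hY.ii t A).1.const_mul N
  have i2 : Integrable ((Ioi A).indicator (fun u => g u * K)) :=
    (h.hg.int.mul_const _).indicator measurableSet_Ioi
  have h4 : ∫ u, g u * Y (t - u) ≤ ∫ u, ((Ioc 0 A).indicator (fun u => N * Y (t - u)) u +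
      (Ioi A).indicator (fun u => g u * K) u) := by
    refine integral_mono_ae (h.hY.cint h.hg t) (i1.add i2) ?_
    have : ∀ᵐ u : ℝ, u ≠ 0 := by simp [ae_iff]
    filter_upwards [this] with u hu
    rcases lt_or_gt_of_ne hu with h0 | h0
    · simp [h.hg.neg u h0, not_lt.2 h0.le, not_lt.2 (h0.trans hA).le]
    · by_cases hu2 : u ≤ A
      · simp only [indicator, mem_Ioc, mem_Ioi, h0, hu2, not_lt.2 hu2, true_and, if_true, if_false,
          add_zero]
        exact mul_le_mul_of_nonneg_right (hN u) (h.hY.nn _)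
      · push Not at hu2
        simp only [indicator, mem_Ioc, mem_Ioi, hu2, not_le.2 hu2, and_false, if_true, if_false,
          zero_add]
        exact mul_le_mul_of_nonneg_left (hK _ (by linarith)) (h.hg.nn _)
  rw [integral_add i1 i2, integral_indicator measurableSet_Ioc,
    integral_indicator measurableSet_Ioi, integral_mul_const, integral_const_mul, hA2,
    ← intervalIntegral.integral_of_le hA.le] at h4
  have h5 := mul_le_mul_of_nonneg_left (h.window hA2 t) hN0
  have := h.eq t
  have := hM t
  linarith

theorem RN.bounded {F g Y : ℝ → ℝ} (h : RN F g Y) : ∃ K : ℝ, ∀ t, Y t ≤ K := by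
  obtain ⟨B, hB⟩ := h.step
  refine ⟨2 * B, fun T => ?_⟩
  obtain ⟨K, hK⟩ := h.hY.bd T
  have hb : BddAbove (Y '' Iic T) := ⟨K, by rintro _ ⟨t, ht, rfl⟩; exact hK t ht⟩
  have h1 : ∀ t ≤ T, Y t ≤ sSup (Y '' Iic T) := fun t ht => le_csSup hb ⟨t, ht, rfl⟩
  have h2 := hB T _ ((h.hY.nn T).trans (h1 T le_rfl)) h1
  have h3 : sSup (Y '' Iic T) ≤ B + sSup (Y '' Iic T) / 2 :=
    csSup_le ⟨_, T, self_mem_Iic, rfl⟩ (by rintro _ ⟨t, ht, rfl⟩; exact h2 t ht)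
  have := h1 T le_rfl
  linarith

theorem RN.dissip {F g Y : ℝ → ℝ} (h : RN F g Y) :
    Integrable (fun t => ∫ u, g u * (Y (t - u) - ∫ u, g u * Y (t - u)) ^ 2) := by
  obtain ⟨K, hK⟩ := h.bounded
  have hK0 : 0 ≤ K := (h.hY.nn 0).trans (hK 0)
  have hV : LB (fun t => Y t ^ 2) := ⟨h.hY.meas.pow_const 2, fun t => sq_nonneg _,
    fun t ht => by simp [h.hY.neg t ht], fun T => ⟨K ^ 2, fun t _ =>
      pow_le_pow_left₀ (h.hY.nn t) (hK t) 2⟩⟩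
  have hv := fun t => (h.hg.var h.hY.meas (K := K) (t := t) fun s _ => by
    rw [abs_of_nonneg (h.hY.nn s)]; exact hK s).2
  have hz : ∀ t, ∫ u, g u * Y (t - u) = Y t - F t := fun t => by rw [h.eq t]; ring
  have e : (fun t => ∫ u, g u * (Y (t - u) - ∫ u, g u * Y (t - u)) ^ 2) =
      fun t => (∫ u, g u * Y (t - u) ^ 2) - (Y t - F t) ^ 2 := by
    ext t; rw [hv t, hz t]
  have hZ : LB (fun t => (Y t - F t) ^ 2) := by
    refine ⟨(h.hY.meas.sub h.hF.meas).pow_const 2, fun t => sq_nonneg _,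
      fun t ht => by simp [h.hY.neg t ht, h.hF.neg t ht], fun T => ⟨K ^ 2, fun t _ => ?_⟩⟩
    refine pow_le_pow_left₀ ?_ ?_ 2
    · rw [← hz]
      exact integral_nonneg fun u => mul_nonneg (h.hg.nn u) (h.hY.nn _)
    · linarith [hK t, h.hF.nn t]
  have hi : ∀ T, IntegrableOn (fun t => ∫ u, g u * Y (t - u) ^ 2) (Iic T) := fun T =>
    (hV.pint h.hg T).integral_prod_left
  refine (aecover_Iic (μ := volume) (tendsto_id (α := ℝ) (x := atTop))
    ).integrable_of_integral_bounded_of_nonneg_ae (2 * K * ∫ s, F s) ?_ ?_ ?_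
  · intro T
    rw [e]
    exact (hi T).sub (hZ.intOn T)
  · exact Eventually.of_forall fun t => integral_nonneg fun u =>
      mul_nonneg (h.hg.nn u) (sq_nonneg _)
  · refine Eventually.of_forall fun T => ?_
    rw [e]
    simp only [id]
    rw [integral_sub (hi T) (hZ.intOn T), hV.fub h.hg T]
    have h1 : ∫ u, g u * ∫ t in Iic (T - u), Y t ^ 2 ≤ ∫ t in Iic T, Y t ^ 2 := by
      have : ∫ u, g u * ∫ t in Iic (T - u), Y t ^ 2 ≤ ∫ u, g u * ∫ t in Iic T, Y t ^ 2 := by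
        refine integral_mono (hV.fubint h.hg T) (h.hg.int.mul_const _) fun u => ?_
        by_cases h0 : u < 0
        · simp [h.hg.neg u h0]
        · exact mul_le_mul_of_nonneg_left (hV.mono (by linarith)) (h.hg.nn u)
      rwa [integral_mul_const, h.hg.one, one_mul] at this
    have h2 : ∫ t in Iic T, Y t ^ 2 ≤ ∫ t in Iic T, ((Y t - F t) ^ 2 + 2 * K * F t) := by
      refine integral_mono (hV.intOn T) ((hZ.intOn T).add ((h.hF.intOn T).const_mul _))
        fun t => ?_
      simp only
      nlinarith [mul_nonneg (sub_nonneg.2 (hK t)) (h.hF.nn t), sq_nonneg (F t)]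
    rw [integral_add (hZ.intOn T) ((h.hF.intOn T).const_mul _), integral_const_mul] at h2
    have h3 := mul_le_mul_of_nonneg_left (h.Fle T) (show 0 ≤ 2 * K by linarith)
    linarith

theorem RN.ae_mem {F g Y : ℝ → ℝ} (h : RN F g Y) :
    ∀ᵐ u, g u ≠ 0 → MemLp (fun t => Y (t - u) - Y t) 2 := by
  obtain ⟨K, hK⟩ := h.bounded
  have hz : ∀ t, ∫ u, g u * Y (t - u) = Y t - F t := fun t => by rw [h.eq t]; ring
  have hv := fun t => (h.hg.var h.hY.meas (K := K) (t := t) fun s _ => by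
    rw [abs_of_nonneg (h.hY.nn s)]; exact hK s).1
  have hd := h.dissip
  simp only [hz] at hv hd
  have hp : Integrable (fun p : ℝ × ℝ => g p.2 * (Y (p.1 - p.2) - (Y p.1 - F p.1)) ^ 2)
      (volume.prod volume) := by
    rw [integrable_prod_iff]
    · refine ⟨Eventually.of_forall hv, hd.congr (Eventually.of_forall fun t => ?_)⟩
      refine integral_congr_ae (Eventually.of_forall fun u => ?_)
      exact (Real.norm_of_nonneg (mul_nonneg (h.hg.nn u) (sq_nonneg _))).symm
    · apply Measurable.aestronglyMeasurable
      have := h.hg.meas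
      have := h.hY.meas
      have := h.hF.meas
      fun_prop
  have hF2 : MemLp F 2 := by
    obtain ⟨M, hM⟩ := h.Fb
    rw [memLp_two_iff_integrable_sq h.hF.meas.aestronglyMeasurable]
    refine Integrable.mono' (h.Fi.const_mul M) (h.hF.meas.pow_const 2).aestronglyMeasurable ?_
    refine Eventually.of_forall fun t => ?_
    rw [Real.norm_of_nonneg (sq_nonneg _), sq]
    exact mul_le_mul_of_nonneg_right (hM t) (h.hF.nn t)
  filter_upwards [hp.prod_left_ae] with u hu hgu
  have h1 : Integrable (fun t => (Y (t - u) - (Y t - F t)) ^ 2) := by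
    refine (hu.const_mul (g u)⁻¹).congr (Eventually.of_forall fun t => ?_)
    simp only
    field_simp
  have h2 : MemLp (fun t => Y (t - u) - (Y t - F t)) 2 := by
    rw [memLp_two_iff_integrable_sq]
    · exact h1
    · have := h.hY.meas
      have := h.hF.meas
      exact Measurable.aestronglyMeasurable (by fun_prop)
  refine (h2.sub hF2).ae_eq (Eventually.of_forall fun t => ?_)
  simp only [Pi.sub_apply]
  ring

/-- The group of translations changing `Y` by an `L²` function. -/
def transGroup (Y : ℝ → ℝ) : AddSubgroup ℝ where
  carrier := {c | MemLp (fun t => Y (t - c) - Y t) 2}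
  zero_mem' := by
    simp
  add_mem' := by
    intro a b ha hb
    simp only [mem_ofPred_eq] at *
    have h1 := ha.comp_measurePreserving (measurePreserving_sub_right volume b)
    refine (h1.add hb).ae_eq (Eventually.of_forall fun t => ?_)
    simp only [Pi.add_apply, Function.comp]
    rw [show t - b - a = t - (a + b) by ring]
    ring
  neg_mem' := by
    intro a ha
    simp only [mem_ofPred_eq] at *
    have h1 := ha.comp_measurePreserving (measurePreserving_add_right volume a)
    refine h1.neg.ae_eq (Eventually.of_forall fun t => ?_)
    simp only [Pi.neg_apply, Function.comp]
    rw [add_sub_cancel_right, sub_neg_eq_add]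
    ring

theorem RN.memLp {F g Y : ℝ → ℝ} (h : RN F g Y) (c : ℝ) :
    MemLp (fun t => Y (t - c) - Y t) 2 := by
  have h1 := h.ae_mem
  obtain ⟨N, hN, hNm, hN0⟩ := exists_measurable_superset_of_null (ae_iff.1 h1)
  set E : Set ℝ := {u | g u ≠ 0} \ N with hE
  have hEm : MeasurableSet E :=
    (h.hg.meas (measurableSet_singleton (0:ℝ)).compl).diff hNm
  have hEp : 0 < volume E := by
    rw [hE, measure_sdiff_null hN0, pos_iff_ne_zero]
    intro h0
    have : g =ᵐ[volume] 0 := h0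
    have h2 := integral_congr_ae this
    rw [h.hg.one] at h2
    simp at h2
  have hsub : E ⊆ transGroup Y := by
    rintro u ⟨hu, huN⟩
    by_contra hc
    exact huN (hN (by simpa using ⟨hu, hc⟩))
  have hn : (transGroup Y : Set ℝ) ∈ nhds (0:ℝ) := by
    refine mem_of_superset (Measure.sub_mem_nhds_zero_of_addHaar_pos volume E hEm hEp) ?_
    rintro _ ⟨a, ha, b, hb, rfl⟩
    exact (transGroup Y).sub_mem (hsub ha) (hsub hb)
  have ho := (transGroup Y).isOpen_of_mem_nhds hn
  have hu := IsClopen.eq_univ ⟨(transGroup Y).isClosed_of_isOpen ho, ho⟩ ⟨0, (transGroup Y).zero_mem⟩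
  have : c ∈ (transGroup Y : Set ℝ) := by rw [hu]; trivial
  exact this

theorem RN.shift {F g Y : ℝ → ℝ} (h : RN F g Y) (c : ℝ) :
    Tendsto (fun t => Y (t - c) - Y t) atTop (nhds 0) := by
  obtain ⟨K, hK⟩ := h.bounded
  obtain ⟨N, hN⟩ := h.gb
  have hYa : ∀ t, |Y t| ≤ K := fun t => by rw [abs_of_nonneg (h.hY.nn t)]; exact hK t
  set d : ℝ → ℝ := fun t => Y (t - c) - Y t with hd
  have hdm : Measurable d := (h.hY.meas.comp (measurable_id.sub_const c)).sub h.hY.meas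
  have hdb : ∀ t, |d t| ≤ K + K := fun t =>
    (abs_sub _ _).trans (add_le_add (hYa _) (hYa _))
  have hd2 : Integrable (fun t => d t ^ 2) :=
    (memLp_two_iff_integrable_sq hdm.aestronglyMeasurable).1 (h.memLp c)
  have hq : Tendsto (fun t => ∫ u, g u * d (t - u) ^ 2) atTop (nhds 0) := by
    have e : ∀ t, ∫ u, g u * d (t - u) ^ 2 = ∫ s, g (t - s) * d s ^ 2 := by
      intro t
      rw [← integral_sub_left_eq_self _ volume t]
      simp
    simp only [e]
    rw [show nhds (0:ℝ) = nhds (∫ s : ℝ, 0) by simp]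
    refine tendsto_integral_filter_of_dominated_convergence (fun s => N * d s ^ 2) ?_ ?_
      (hd2.const_mul N) ?_
    · have := h.hg.meas
      exact Eventually.of_forall fun t => Measurable.aestronglyMeasurable (by fun_prop)
    · refine Eventually.of_forall fun t => Eventually.of_forall fun s => ?_
      rw [Real.norm_of_nonneg (mul_nonneg (h.hg.nn _) (sq_nonneg _))]
      exact mul_le_mul_of_nonneg_right (hN _) (sq_nonneg _)
    · refine Eventually.of_forall fun s => ?_
      have h1 : Tendsto (fun t => g (t - s)) atTop (nhds 0) :=
        h.glim.comp (tendsto_atTop_add_const_right _ (-s) tendsto_id)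
      simpa using h1.mul_const (d s ^ 2)
  have hw : Tendsto (fun t => ∫ u, g u * d (t - u)) atTop (nhds 0) := by
    have h1 : Tendsto (fun t => |∫ u, g u * d (t - u)|) atTop (nhds 0) := by
      have h2 : Tendsto (fun t => Real.sqrt (∫ u, g u * d (t - u) ^ 2)) atTop (nhds 0) := by
        simpa using hq.sqrt
      refine squeeze_zero (fun t => abs_nonneg _) (fun t => ?_) h2
      apply Real.abs_le_sqrt
      have h3 := (h.hg.var hdm (t := t) fun s _ => hdb s).2
      have h4 : 0 ≤ ∫ u, g u * (d (t - u) - ∫ u, g u * d (t - u)) ^ 2 :=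
        integral_nonneg fun u => mul_nonneg (h.hg.nn u) (sq_nonneg _)
      linarith
    exact (tendsto_zero_iff_abs_tendsto_zero _).2 h1
  have e : d = fun t => (F (t - c) - F t) + ∫ u, g u * d (t - u) := by
    ext t
    have : ∫ u, g u * d (t - u) = (∫ u, g u * Y (t - c - u)) - ∫ u, g u * Y (t - u) := by
      rw [← integral_sub (h.hY.cint h.hg _) (h.hY.cint h.hg _)]
      congr 1
      ext u
      simp only [hd]
      rw [show t - u - c = t - c - u by ring]
      ring
    rw [this]
    simp only [hd]
    rw [h.eq (t - c), h.eq t]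
    ring
  rw [e]
  have h1 : Tendsto (fun t => F (t - c)) atTop (nhds 0) :=
    h.Flim.comp (tendsto_atTop_add_const_right _ (-c) tendsto_id)
  simpa using (h1.sub h.Flim).add hw

theorem PD.mpos {g : ℝ → ℝ} (hg : PD g) (hi : Integrable (fun u => u * g u)) :
    0 < ∫ u, u * g u := by
  have hnn : ∀ u, 0 ≤ u * g u := fun u => by
    by_cases h0 : u < 0
    · simp [hg.neg u h0]
    · exact mul_nonneg (not_lt.1 h0) (hg.nn u)
  refine lt_of_le_of_ne (integral_nonneg hnn) fun h0 => ?_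
  have h1 := (integral_eq_zero_iff_of_nonneg hnn hi).1 h0.symm
  have h2 : g =ᵐ[volume] 0 := by
    have : ∀ᵐ u : ℝ, u ≠ 0 := by simp [ae_iff]
    filter_upwards [h1, this] with u hu hu0
    simpa [hu0] using hu
  have h3 := integral_congr_ae h2
  rw [hg.one] at h3
  simp at h3

theorem RN.main {F g Y : ℝ → ℝ} (h : RN F g Y) :
    Tendsto Y atTop (nhds ((∫ s, F s) / ∫ u, u * g u)) := by
  obtain ⟨K, hK⟩ := h.bounded
  have hYa : ∀ t, |Y t| ≤ K := fun t => by rw [abs_of_nonneg (h.hY.nn t)]; exact hK t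
  have hm := h.hg.mpos h.sgi
  set m := ∫ u, u * g u with hmdef
  -- inner convergence
  have hin : ∀ u, Tendsto (fun t => ∫ a in (0:ℝ)..u, (Y (t - a) - Y t)) atTop (nhds 0) := by
    intro u
    rw [show nhds (0:ℝ) = nhds (∫ a in (0:ℝ)..u, (0:ℝ)) by simp]
    refine intervalIntegral.tendsto_integral_filter_of_dominated_convergence (fun _ => K + K)
      ?_ ?_ (by simp) ?_
    · have := h.hY.meas
      exact Eventually.of_forall fun t => Measurable.aestronglyMeasurable (by fun_prop)
    · exact Eventually.of_forall fun t => Eventually.of_forall fun a _ =>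
        (abs_sub _ _).trans (add_le_add (hYa _) (hYa _))
    · exact Eventually.of_forall fun a _ => h.shift a
  have ek : ∀ t u, ∫ a in (0:ℝ)..u, (Y (t - a) - Y t) =
      ((∫ s in Iic t, Y s) - ∫ s in Iic (t - u), Y s) - u * Y t := by
    intro t u
    rw [intervalIntegral.integral_sub (h.hY.ii t u) intervalIntegrable_const, h.hY.kform]
    simp
  have hout : Tendsto (fun t => ∫ u, g u * ∫ a in (0:ℝ)..u, (Y (t - a) - Y t)) atTop
      (nhds 0) := by
    rw [show nhds (0:ℝ) = nhds (∫ u : ℝ, (0:ℝ)) by simp]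
    refine tendsto_integral_filter_of_dominated_convergence (fun u => (K + K) * (u * g u)) ?_ ?_
      (h.sgi.const_mul _) ?_
    · refine Eventually.of_forall fun t => ?_
      have := ((h.cons t).1.sub (h.sgi.const_mul (Y t))).aestronglyMeasurable
      refine this.congr (Eventually.of_forall fun u => ?_)
      simp only [ek, Pi.sub_apply]
      ring
    · refine Eventually.of_forall fun t => Eventually.of_forall fun u => ?_
      rw [norm_mul, Real.norm_of_nonneg (h.hg.nn u)]
      by_cases h0 : u < 0
      · simp [h.hg.neg u h0]
      · have := intervalIntegral.norm_integral_le_of_norm_le_const (a := 0) (b := u)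
          (f := fun a => Y (t - a) - Y t) (C := K + K) fun a _ =>
            (abs_sub _ _).trans (add_le_add (hYa _) (hYa _))
        rw [sub_zero, abs_of_nonneg (not_lt.1 h0)] at this
        calc _ ≤ g u * ((K + K) * u) := mul_le_mul_of_nonneg_left this (h.hg.nn u)
          _ = _ := by ring
    · refine Eventually.of_forall fun u => ?_
      simpa using (hin u).const_mul (g u)
  have eo : ∀ t, ∫ u, g u * ∫ a in (0:ℝ)..u, (Y (t - a) - Y t) =
      (∫ s in Iic t, F s) - Y t * m := by
    intro t
    rw [← (h.cons t).2, hmdef, ← integral_const_mul,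
      ← integral_sub (h.cons t).1 (h.sgi.const_mul _)]
    congr 1
    ext u
    rw [ek]
    ring
  simp only [eo] at hout
  have hF : Tendsto (fun t => ∫ s in Iic t, F s) atTop (nhds (∫ s, F s)) :=
    (aecover_Iic (μ := volume) (tendsto_id (α := ℝ) (x := atTop))
      ).integral_tendsto_of_countably_generated h.Fi
  have h1 := (hF.sub hout).div_const m
  simp only [sub_zero] at h1
  refine h1.congr fun t => ?_
  field_simp
  ring

theorem Gν_meas (α : ℝ) (ν : MeasureTheory.SignedMeasure ℝ) {ψ : ℝ → ℝ} (hψ : Measurable ψ) :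
    Measurable (Gν α ν ψ) := by
  have h : StronglyMeasurable (Function.uncurry fun t u : ℝ => ψ (t + u)) :=
    (hψ.comp (measurable_fst.add measurable_snd)).stronglyMeasurable
  exact (h.integral_prod_right (ν := ν.toJordanDecomposition.posPart.restrict (Icc (-α) 0))
    ).measurable.sub (h.integral_prod_right
      (ν := ν.toJordanDecomposition.negPart.restrict (Icc (-α) 0))).measurable

theorem Gν_bound (α : ℝ) (ν : MeasureTheory.SignedMeasure ℝ) {ψ : ℝ → ℝ} {D γ : ℝ}
    (hD : 0 ≤ D) (hγ : 0 < γ) (h : ∀ s ≥ -α, |ψ s| ≤ D * Real.exp (-γ * s)) :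
    ∃ N : ℝ, ∀ t ≥ 0, |Gν α ν ψ t| ≤ N * Real.exp (-γ * t) := by
  have key : ∀ (μ : Measure ℝ) [IsFiniteMeasure μ], ∀ t ≥ 0,
      |∫ u in Icc (-α) 0, ψ (t + u) ∂μ| ≤
        (D * Real.exp (γ * α) * μ.real (Icc (-α) 0)) * Real.exp (-γ * t) := by
    intro μ _ t ht
    have := norm_setIntegral_le_of_norm_le_const (μ := μ) (s := Icc (-α) 0)
      (f := fun u => ψ (t + u)) (C := D * (Real.exp (γ * α) * Real.exp (-γ * t)))
      (measure_lt_top _ _) (by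
        intro u hu
        refine (h (t + u) (by linarith [hu.1])).trans ?_
        refine mul_le_mul_of_nonneg_left ?_ hD
        rw [← Real.exp_add]
        apply Real.exp_le_exp.2
        nlinarith [hu.1])
    rw [Real.norm_eq_abs] at this
    refine this.trans (le_of_eq ?_)
    ring
  refine ⟨D * Real.exp (γ * α) * ν.toJordanDecomposition.posPart.real (Icc (-α) 0) +
    D * Real.exp (γ * α) * ν.toJordanDecomposition.negPart.real (Icc (-α) 0), fun t ht => ?_⟩
  rw [add_mul]
  exact (abs_sub _ _).trans (add_le_add (key _ t ht) (key _ t ht))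

/-- Facts on the extension by zero of the square of an exponentially decaying function. -/
theorem ext_facts {p G : ℝ → ℝ} {N γ : ℝ} (hγ : 0 < γ) (hG : Measurable G)
    (hp : ∀ t ≥ (0:ℝ), p t = G t ^ 2) (hb : ∀ t ≥ 0, |G t| ≤ N * Real.exp (-γ * t)) :
    Measurable ((Ici (0:ℝ)).indicator p) ∧ (∀ t, 0 ≤ (Ici (0:ℝ)).indicator p t) ∧
    (∀ t < 0, (Ici (0:ℝ)).indicator p t = 0) ∧
    (∃ M, ∀ t, (Ici (0:ℝ)).indicator p t ≤ M) ∧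
    Integrable ((Ici (0:ℝ)).indicator p) ∧
    Integrable (fun u => u * (Ici (0:ℝ)).indicator p u) ∧
    Tendsto ((Ici (0:ℝ)).indicator p) atTop (nhds 0) := by
  have e : (Ici (0:ℝ)).indicator p = (Ici (0:ℝ)).indicator (fun t => G t ^ 2) :=
    indicator_congr fun t ht => hp t ht
  rw [e]
  have hm : Measurable ((Ici (0:ℝ)).indicator (fun t => G t ^ 2)) :=
    (hG.pow_const 2).indicator measurableSet_Ici
  have hnn : ∀ t, 0 ≤ (Ici (0:ℝ)).indicator (fun t => G t ^ 2) t := fun t =>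
    indicator_nonneg (fun _ _ => sq_nonneg _) t
  have hneg : ∀ t < 0, (Ici (0:ℝ)).indicator (fun t => G t ^ 2) t = 0 := fun t ht =>
    indicator_of_notMem (by simpa using ht) _
  have hB : ∀ t ≥ 0, (Ici (0:ℝ)).indicator (fun t => G t ^ 2) t ≤
      N ^ 2 * (Real.exp (-γ * t) * Real.exp (-γ * t)) := by
    intro t ht
    rw [indicator_of_mem (by exact ht), ← sq_abs]
    have := pow_le_pow_left₀ (abs_nonneg _) (hb t ht) 2
    nlinarith
  have hB1 : ∀ t ≥ 0, (Ici (0:ℝ)).indicator (fun t => G t ^ 2) t ≤ N ^ 2 * Real.exp (-γ * t) := by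
    intro t ht
    refine (hB t ht).trans (mul_le_mul_of_nonneg_left ?_ (sq_nonneg _))
    have : Real.exp (-γ * t) ≤ 1 := Real.exp_le_one_iff.2 (by nlinarith)
    nlinarith [Real.exp_pos (-γ * t)]
  have hE : Integrable ((Ici (0:ℝ)).indicator fun t => Real.exp (-γ * t)) := by
    rw [integrable_indicator_iff measurableSet_Ici, integrableOn_Ici_iff_integrableOn_Ioi]
    exact exp_neg_integrableOn_Ioi 0 hγ
  refine ⟨hm, hnn, hneg, ⟨N ^ 2, fun t => ?_⟩, ?_, ?_, ?_⟩
  · by_cases h0 : t < 0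
    · rw [hneg t h0]; positivity
    · refine (hB1 t (not_lt.1 h0)).trans ?_
      have : Real.exp (-γ * t) ≤ 1 := Real.exp_le_one_iff.2 (by nlinarith)
      nlinarith [sq_nonneg N]
  · refine Integrable.mono' (hE.const_mul (N ^ 2)) hm.aestronglyMeasurable
      (Eventually.of_forall fun t => ?_)
    rw [Real.norm_of_nonneg (hnn t)]
    by_cases h0 : t < 0
    · rw [hneg t h0, indicator_of_notMem (by simpa using h0)]; simp
    · rw [indicator_of_mem (s := Ici (0:ℝ)) (f := fun t => Real.exp (-γ * t))
        (by exact not_lt.1 h0)]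
      exact hB1 t (not_lt.1 h0)
  · refine Integrable.mono' (hE.const_mul (N ^ 2 / γ)) (measurable_id.mul hm).aestronglyMeasurable
      (Eventually.of_forall fun t => ?_)
    by_cases h0 : t < 0
    · simp only [hneg t h0, indicator_of_notMem (show t ∉ Ici (0:ℝ) by simpa using h0)]; simp
    · have h0' := not_lt.1 h0
      rw [Real.norm_of_nonneg (mul_nonneg h0' (hnn t)),
        indicator_of_mem (s := Ici (0:ℝ)) (f := fun t => Real.exp (-γ * t)) (by exact h0')]
      have h1 : γ * t * Real.exp (-γ * t) ≤ 1 := by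
        have h2 := Real.add_one_le_exp (γ * t)
        have h3 : Real.exp (γ * t) * Real.exp (-γ * t) = 1 := by
          rw [← Real.exp_add]; simp
        nlinarith [Real.exp_pos (-γ * t)]
      have h2 : t * Real.exp (-γ * t) ≤ 1 / γ := by
        rw [le_div_iff₀ hγ]; linarith
      calc _ ≤ t * (N ^ 2 * (Real.exp (-γ * t) * Real.exp (-γ * t))) :=
            mul_le_mul_of_nonneg_left (hB t h0') h0'
        _ = N ^ 2 * (t * Real.exp (-γ * t)) * Real.exp (-γ * t) := by ring
        _ ≤ N ^ 2 * (1 / γ) * Real.exp (-γ * t) := by gcongr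
        _ = _ := by ring
  · have h1 : Tendsto (fun t => N ^ 2 * Real.exp (-γ * t)) atTop (nhds 0) := by
      have h2 : Tendsto (fun t : ℝ => -γ * t) atTop atBot :=
        tendsto_id.const_mul_atTop_of_neg (by linarith)
      simpa using (Real.tendsto_exp_atBot.comp h2).const_mul (N ^ 2)
    refine squeeze_zero' (Eventually.of_forall hnn) ?_ h1
    filter_upwards [eventually_ge_atTop 0] with t ht using hB1 t ht

theorem ind_int (p : ℝ → ℝ) : ∫ s, (Ici (0:ℝ)).indicator p s = ∫ s in Ioi (0:ℝ), p s := by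
  rw [integral_indicator measurableSet_Ici, integral_Ici_eq_integral_Ioi]

theorem ind_conv (g y : ℝ → ℝ) {t : ℝ} (ht : 0 ≤ t) :
    ∫ u, (Ici (0:ℝ)).indicator g u * (Ici (0:ℝ)).indicator y (t - u) =
      ∫ s in (0:ℝ)..t, g (t - s) * y s := by
  rw [intervalIntegral.integral_of_le ht, ← integral_Icc_eq_integral_Ioc,
    ← integral_indicator measurableSet_Icc, ← integral_sub_left_eq_self _ volume t]
  congr 1
  ext s
  rw [sub_sub_cancel]
  by_cases h1 : 0 ≤ s
  · by_cases h2 : s ≤ t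
    · simp [indicator, h1, h2]
    · simp [indicator, h2]
  · simp [indicator, h1]

/-- Intermediate step in the proof of Theorem 3.2(b): in the critical case,
the solution of the renewal equation converges. -/
theorem stmt4 (α : ℝ) (hα : 0 ≤ α) (ν : MeasureTheory.SignedMeasure ℝ)
    (C γ : ℝ) (hC : 0 < C) (hγ : 0 < γ)
    (r : ℝ → ℝ) (hrmeas : Measurable r) (hrneg : ∀ u < (0:ℝ), r u = 0)
    (hrdecay : ∀ t ≥ (0:ℝ), |r t| ≤ C * Real.exp (-γ * t))
    (x : ℝ → ℝ) (hxcont : Continuous x)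
    (hxdecay : ∀ t ≥ (0:ℝ), |x t| ≤ C * Real.exp (-γ * t))
    (f g : ℝ → ℝ)
    (hf : ∀ t ≥ (0:ℝ), f t = (Gν α ν x t) ^ 2)
    (hg : ∀ t ≥ (0:ℝ), g t = (Gν α ν r t) ^ 2)
    (y : ℝ → ℝ) (hymeas : Measurable y) (hynn : ∀ t ≥ (0:ℝ), 0 ≤ y t)
    (hybdd : ∀ T : ℝ, ∃ K : ℝ, ∀ t ∈ Set.Icc (0:ℝ) T, y t ≤ K)
    (hren : ∀ t ≥ (0:ℝ), y t = f t + ∫ s in (0:ℝ)..t, g (t - s) * y s)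
    (hcritical : (∫ s in Set.Ioi (0:ℝ), g s) = 1) :
    MeasureTheory.IntegrableOn (fun s => s * g s) (Set.Ioi 0) ∧
    0 < (∫ s in Set.Ioi (0:ℝ), s * g s) ∧
    Tendsto y atTop (nhds
      ((∫ s in Set.Ioi (0:ℝ), f s) / (∫ s in Set.Ioi (0:ℝ), s * g s))) := by
  have hxb : ∃ D : ℝ, 0 ≤ D ∧ ∀ s ≥ -α, |x s| ≤ D * Real.exp (-γ * s) := by
    obtain ⟨B, hB⟩ := (isCompact_Icc (a := -α) (b := 0)).exists_bound_of_continuousOn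
      hxcont.continuousOn
    refine ⟨max B C, hC.le.trans (le_max_right _ _), fun s hs => ?_⟩
    by_cases h0 : s ≤ 0
    · have h1 : 1 ≤ Real.exp (-γ * s) := Real.one_le_exp (by nlinarith)
      have h2 := hB s ⟨hs, h0⟩
      rw [Real.norm_eq_abs] at h2
      have h3 := h2.trans (le_max_left B C)
      nlinarith [abs_nonneg (x s)]
    · refine (hxdecay s (not_le.1 h0).le).trans ?_
      gcongr
      exact le_max_right _ _
  have hrb : ∀ s ≥ -α, |r s| ≤ C * Real.exp (-γ * s) := by
    intro s _
    by_cases h0 : s < 0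
    · rw [hrneg s h0]; simp; positivity
    · exact hrdecay s (not_lt.1 h0)
  obtain ⟨D, hD, hxD⟩ := hxb
  obtain ⟨N1, hN1⟩ := Gν_bound α ν hD hγ hxD
  obtain ⟨N2, hN2⟩ := Gν_bound α ν hC.le hγ hrb
  obtain ⟨f1, f2, f3, f4, f5, -, f7⟩ := ext_facts hγ (Gν_meas α ν hxcont.measurable) hf hN1
  obtain ⟨g1, g2, g3, g4, g5, g6, g7⟩ := ext_facts hγ (Gν_meas α ν hrmeas) hg hN2
  have hR : RN ((Ici (0:ℝ)).indicator f) ((Ici (0:ℝ)).indicator g) ((Ici (0:ℝ)).indicator y) := by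
    refine ⟨⟨f1, f2, f3, fun T => ?_⟩, ⟨g1, g2, g3, g5, ?_⟩, ⟨?_, ?_, ?_, ?_⟩, f4, g4, f5, g6,
      f7, g7, fun t => ?_⟩
    · obtain ⟨M, hM⟩ := f4
      exact ⟨M, fun t _ => hM t⟩
    · rw [ind_int, hcritical]
    · exact hymeas.indicator measurableSet_Ici
    · exact fun t => indicator_nonneg (fun t ht => hynn t ht) t
    · exact fun t ht => indicator_of_notMem (by simpa using ht) _
    · intro T
      obtain ⟨K, hK⟩ := hybdd T
      refine ⟨max K 0, fun t ht => ?_⟩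
      by_cases h0 : 0 ≤ t
      · rw [indicator_of_mem (by exact h0)]
        exact (hK t ⟨h0, ht⟩).trans (le_max_left _ _)
      · rw [indicator_of_notMem (by simpa using h0)]
        exact le_max_right _ _
    · by_cases h0 : 0 ≤ t
      · rw [ind_conv g y h0, indicator_of_mem (by exact h0), indicator_of_mem (by exact h0)]
        exact hren t h0
      · rw [indicator_of_notMem (by simpa using h0), indicator_of_notMem (by simpa using h0)]
        rw [integral_eq_zero_of_ae]
        · simp
        · refine Eventually.of_forall fun u => ?_
          by_cases hu : 0 ≤ u
          · have : (Ici (0:ℝ)).indicator y (t - u) = 0 :=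
              indicator_of_notMem (by simp only [mem_Ici, not_le] at *; linarith) _
            simp [this]
          · have : (Ici (0:ℝ)).indicator g u = 0 :=
              indicator_of_notMem (by simpa using hu) _
            simp [this]
  have em : (fun u => u * (Ici (0:ℝ)).indicator g u) =
      (Ici (0:ℝ)).indicator (fun u => u * g u) := by
    ext u
    by_cases hu : 0 ≤ u <;> simp [indicator, hu]
  have h1 := hR.main
  have h2 := hR.hg.mpos hR.sgi
  have h3 := hR.sgi
  rw [em] at h3
  simp only [em, ind_int] at h1 h2
  refine ⟨?_, h2, ?_⟩
  · exact ((integrable_indicator_iff measurableSet_Ici).1 h3).mono_set Ioi_subset_Ici_self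
  · refine h1.congr' ?_
    filter_upwards [eventually_ge_atTop 0] with t ht
    exact indicator_of_mem (by exact ht) _
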